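/- arXiv:0912.0911 — 2 statements merged into one kernel-verified Lean document; each statement's English description precedes it below -/
import Mathlib

section
/- Fix types X, Y ∈ {Γ, Δ}. Set A = R_{XX}, C = R_{XY}, B = C‡ (so B(z₁,t₁,z₂,t₂) = P·R_{XY}(z₂,t₂,z₁,t₁)·P) and D = (R_{YY})‡. Then for all complex parameter points p₁=(z₁,t₁), p₂=(z₂,t₂), p₃=(z₃,t₃), all eight Yang–Baxter system relations hold: [A,A,A] = [D,D,D] = [A,C,C] = [D,B,B] = [A,B‡,B‡] = [D,C‡,C‡] = [A,C,B‡] = [D,B,C‡] = 0. -/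
open Matrix

noncomputable section

abbrev M4 : Type := Matrix (Fin 4) (Fin 4) ℂ
abbrev I3 : Type := Fin 2 × Fin 2 × Fin 2
abbrev M8 : Type := Matrix I3 I3 ℂ

/-- Index of `v_a ⊗ v_b` in the ordered basis `(v₊⊗v₊, v₊⊗v₋, v₋⊗v₊, v₋⊗v₋)` of `V ⊗ V`. -/
def idx (a b : Fin 2) : Fin 4 := ⟨2 * a.val + b.val, by have := a.isLt; have := b.isLt; omega⟩

/-- `R₁₂ = R ⊗ I` acting on `V ⊗ V ⊗ V`. -/
def m12 (R : M4) : M8 :=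
  Matrix.of fun p q => R (idx p.1 p.2.1) (idx q.1 q.2.1) * (if p.2.2 = q.2.2 then 1 else 0)

/-- `R₁₃ = (I⊗P)(R⊗I)(I⊗P)`: `R` acting on the first and third factors. -/
def m13 (R : M4) : M8 :=
  Matrix.of fun p q => R (idx p.1 p.2.2) (idx q.1 q.2.2) * (if p.2.1 = q.2.1 then 1 else 0)

/-- `R₂₃ = I ⊗ R` acting on `V ⊗ V ⊗ V`. -/
def m23 (R : M4) : M8 :=
  Matrix.of fun p q => (if p.1 = q.1 then 1 else 0) * R (idx p.2.1 p.2.2) (idx q.2.1 q.2.2)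

/-- The Yang–Baxter commutator `⟦R,S,T⟧ = R₁₂ S₁₃ T₂₃ − T₂₃ S₁₃ R₁₂`. -/
def ybc (R S T : M4) : M8 := m12 R * m13 S * m23 T - m23 T * m13 S * m12 R

/-- The six-vertex matrix with Boltzmann weights `a₁ a₂ b₁ b₂ c₁ c₂` (and `d₁ = d₂ = 0`). -/
def sixV (a₁ a₂ b₁ b₂ c₁ c₂ : ℂ) : M4 :=
  !![a₁, 0, 0, 0; 0, b₁, c₁, 0; 0, c₂, b₂, 0; 0, 0, 0, a₂]

/-- The general R-matrix with Boltzmann weights `a₁ a₂ b₁ b₂ c₁ c₂ d₁ d₂`. -/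
def rmat (a₁ a₂ b₁ b₂ c₁ c₂ d₁ d₂ : ℂ) : M4 :=
  !![a₁, 0, 0, d₁; 0, b₁, c₁, 0; 0, c₂, b₂, 0; d₂, 0, 0, a₂]

/-- Gamma ice Boltzmann weight matrix. -/
def GammaM (z t : ℂ) : M4 :=
  !![1, 0, 0, 0; 0, t, (t + 1) * z, 0; 0, 1, z, 0; 0, 0, 0, z]

/-- Delta ice Boltzmann weight matrix. -/
def DeltaM (z t : ℂ) : M4 :=
  !![z, 0, 0, 1; 0, z * t, 0, 0; 0, 0, 1, 0; z * (t + 1), 0, 0, 1]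

/-- Gamma-Gamma R-matrix. -/
def RGG (z₁ t₁ z₂ t₂ : ℂ) : M4 :=
  !![t₂ * z₁ + z₂, 0, 0, 0;
     0, t₁ * z₂ - t₂ * z₁, (t₁ + 1) * z₁, 0;
     0, (t₂ + 1) * z₂, z₁ - z₂, 0;
     0, 0, 0, z₁ + t₁ * z₂]

/-- Delta-Delta R-matrix. -/
def RDD (z₁ t₁ z₂ t₂ : ℂ) : M4 :=
  !![t₁ * z₁ + z₂, 0, 0, 0;
     0, z₁ - z₂, (t₂ + 1) * z₂, 0;
     0, (t₁ + 1) * z₁, t₂ * z₂ - t₁ * z₁, 0;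
     0, 0, 0, t₂ * z₂ + z₁]

/-- Gamma-Delta R-matrix. -/
def RGD (z₁ t₁ z₂ t₂ : ℂ) : M4 :=
  !![t₁ * t₂ * z₂ - z₁, 0, 0, (t₁ + 1) * z₁;
     0, t₂ * z₂ + z₁, 0, 0;
     0, 0, t₁ * z₂ + z₁, 0;
     (t₂ + 1) * z₂, 0, 0, z₁ - z₂]

/-- Delta-Gamma R-matrix. -/
def RDG (z₁ t₁ z₂ t₂ : ℂ) : M4 :=
  !![z₁ - z₂, 0, 0, (t₂ + 1) * z₂;
     0, t₁ * z₁ + z₂, 0, 0;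
     0, 0, t₂ * z₁ + z₂, 0;
     (t₁ + 1) * z₁, 0, 0, z₂ - t₁ * t₂ * z₁]

/-- The two types of ice, Gamma and Delta. -/
inductive IceType
  | Gamma : IceType
  | Delta : IceType

/-- The R-matrix `R_{XY}` for types `X, Y ∈ {Γ, Δ}`. -/
def Rice : IceType → IceType → ℂ → ℂ → ℂ → ℂ → M4
  | .Gamma, .Gamma => RGG
  | .Gamma, .Delta => RGD
  | .Delta, .Gamma => RDG
  | .Delta, .Delta => RDD

/-- The flip matrix `P` on `V ⊗ V`. -/
def Pmat : M4 := !![1, 0, 0, 0; 0, 0, 1, 0; 0, 1, 0, 0; 0, 0, 0, 1]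

/-- `R_{XY}` as a function of two parameter points `(z, t)`. -/
def RiceP (X Y : IceType) (p q : ℂ × ℂ) : M4 := Rice X Y p.1 p.2 q.1 q.2

/-- The involution `U ↦ U‡`, `U‡(p₁,p₂) = P · U(p₂,p₁) · P`. -/
def ddag (U : ℂ × ℂ → ℂ × ℂ → M4) (p q : ℂ × ℂ) : M4 := Pmat * U q p * Pmat

/-- The parametrized Yang–Baxter system bracket
`[U,V,W] = U(p₁,p₂)₁₂ V(p₁,p₃)₁₃ W(p₂,p₃)₂₃ − W(p₂,p₃)₂₃ V(p₁,p₃)₁₃ U(p₁,p₂)₁₂`. -/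
def ybs (U V W : ℂ × ℂ → ℂ × ℂ → M4) (p₁ p₂ p₃ : ℂ × ℂ) : M8 :=
  m12 (U p₁ p₂) * m13 (V p₁ p₃) * m23 (W p₂ p₃)
    - m23 (W p₂ p₃) * m13 (V p₁ p₃) * m12 (U p₁ p₂)

theorem flip_conj_apply_idx (M : M4) (a b c d : Fin 2) :
    (Pmat * M * Pmat) (idx a b) (idx c d) = M (idx b a) (idx d c) := by
  fin_cases a <;> fin_cases b <;> fin_cases c <;> fin_cases d <;>
    simp [Pmat, idx, Matrix.mul_apply, Fin.sum_univ_four, Matrix.vecMul, dotProduct]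

/-- The reversal of the three tensor factors, on basis indices. -/
def revFactors : I3 ≃ I3 where
  toFun p := (p.2.2, p.2.1, p.1)
  invFun p := (p.2.2, p.2.1, p.1)
  left_inv _ := rfl
  right_inv _ := rfl

theorem m12_flip_conj (M : M4) :
    m12 (Pmat * M * Pmat) = (m23 M).submatrix revFactors revFactors := by
  ext p q
  simp [m12, m23, revFactors, flip_conj_apply_idx]

theorem m13_flip_conj (M : M4) :
    m13 (Pmat * M * Pmat) = (m13 M).submatrix revFactors revFactors := by
  ext p q
  simp [m13, revFactors, flip_conj_apply_idx]

theorem m23_flip_conj (M : M4) :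
    m23 (Pmat * M * Pmat) = (m12 M).submatrix revFactors revFactors := by
  ext p q
  simp [m12, m23, revFactors, flip_conj_apply_idx]

theorem ybs_ddag (U V W : ℂ × ℂ → ℂ × ℂ → M4) (p₁ p₂ p₃ : ℂ × ℂ) :
    ybs (ddag U) (ddag V) (ddag W) p₁ p₂ p₃ =
      -(ybs W V U p₃ p₂ p₁).submatrix revFactors revFactors := by
  simp only [ybs, ddag, m12_flip_conj, m13_flip_conj, m23_flip_conj,
    Matrix.submatrix_mul_equiv, Matrix.submatrix_sub, Pi.sub_apply, neg_sub]

theorem ddag_ddag (U : ℂ × ℂ → ℂ × ℂ → M4) : ddag (ddag U) = U := by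
  have h : Pmat * Pmat = 1 := by
    ext i j
    fin_cases i <;> fin_cases j <;> simp [Pmat, Matrix.mul_apply, Fin.sum_univ_four]
  funext p q
  simp only [ddag]
  rw [← mul_assoc, ← mul_assoc, h, one_mul, mul_assoc, h, mul_one]

theorem m12_mul_m13_mul_m23_apply (M N L : M4) (a b c d e f : Fin 2) :
    (m12 M * m13 N * m23 L) (a, b, c) (d, e, f) =
      ∑ x : Fin 2, ∑ y : Fin 2, ∑ z : Fin 2,
        M (idx a b) (idx x y) * N (idx x c) (idx d z) * L (idx y z) (idx e f) := by
  simp only [m12, m13, m23, Matrix.mul_apply, Fintype.sum_prod_type, Matrix.of_apply,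
    Fin.sum_univ_two]
  fin_cases c <;> fin_cases d <;> simp <;> ring

theorem m23_mul_m13_mul_m12_apply (M N L : M4) (a b c d e f : Fin 2) :
    (m23 L * m13 N * m12 M) (a, b, c) (d, e, f) =
      ∑ x : Fin 2, ∑ y : Fin 2, ∑ z : Fin 2,
        L (idx b c) (idx y z) * N (idx a z) (idx x f) * M (idx x y) (idx d e) := by
  simp only [m12, m13, m23, Matrix.mul_apply, Fintype.sum_prod_type, Matrix.of_apply,
    Fin.sum_univ_two]
  fin_cases a <;> fin_cases f <;> simp <;> ring

/-- The R-matrices preserve the parity of the number of minus signs. -/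
theorem RiceP_parity (X Y : IceType) (p q : ℂ × ℂ) :
    RiceP X Y p q 0 1 = 0 ∧
    RiceP X Y p q 0 2 = 0 ∧
    RiceP X Y p q 1 0 = 0 ∧
    RiceP X Y p q 1 3 = 0 ∧
    RiceP X Y p q 2 0 = 0 ∧
    RiceP X Y p q 2 3 = 0 ∧
    RiceP X Y p q 3 1 = 0 ∧
    RiceP X Y p q 3 2 = 0 := by
  cases X <;> cases Y <;> simp [RiceP, Rice, RGG, RDD, RGD, RDG]

set_option maxHeartbeats 4000000 in
theorem ybs_RiceP (X Y Z : IceType) (p₁ p₂ p₃ : ℂ × ℂ) :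
    ybs (RiceP X Y) (RiceP X Z) (RiceP Y Z) p₁ p₂ p₃ = 0 := by
  ext ⟨a, b, c⟩ ⟨d, e, f⟩
  simp only [ybs, Matrix.sub_apply, m12_mul_m13_mul_m23_apply, m23_mul_m13_mul_m12_apply,
    Fin.sum_univ_two, Matrix.zero_apply]
  fin_cases a <;> fin_cases b <;> fin_cases c <;>
  fin_cases d <;> fin_cases e <;> fin_cases f <;>
  simp [idx, RiceP_parity] <;>
  cases X <;> cases Y <;> cases Z <;>
  simp [RiceP, Rice, RGG, RDD, RGD, RDG] <;> ring

theorem stmt14 (X Y : IceType) (p₁ p₂ p₃ : ℂ × ℂ) :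
    ybs (RiceP X X) (RiceP X X) (RiceP X X) p₁ p₂ p₃ = 0 ∧
    ybs (ddag (RiceP Y Y)) (ddag (RiceP Y Y)) (ddag (RiceP Y Y)) p₁ p₂ p₃ = 0 ∧
    ybs (RiceP X X) (RiceP X Y) (RiceP X Y) p₁ p₂ p₃ = 0 ∧
    ybs (ddag (RiceP Y Y)) (ddag (RiceP X Y)) (ddag (RiceP X Y)) p₁ p₂ p₃ = 0 ∧
    ybs (RiceP X X) (ddag (ddag (RiceP X Y))) (ddag (ddag (RiceP X Y))) p₁ p₂ p₃ = 0 ∧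
    ybs (ddag (RiceP Y Y)) (ddag (RiceP X Y)) (ddag (RiceP X Y)) p₁ p₂ p₃ = 0 ∧
    ybs (RiceP X X) (RiceP X Y) (ddag (ddag (RiceP X Y))) p₁ p₂ p₃ = 0 ∧
    ybs (ddag (RiceP Y Y)) (ddag (RiceP X Y)) (ddag (RiceP X Y)) p₁ p₂ p₃ = 0 := by
  simp [ddag_ddag, ybs_ddag, ybs_RiceP]
end
end

section
/- (Evaluation of the Gamma-ice partition function.) For every n ≥ 1 and every partition λ with at most n parts, the following identity of polynomials in z₁,…,z_n and t₁,…,t_n holds: Z_λ(z₁,…,z_n; t₁,…,t_n) · ∏_{1≤i<j≤n} (z_i − z_j) = ∏_{1≤i<j≤n} (t_i z_j + z_i) · det( z_i^{λ_j + n − j} )_{1≤i,j≤n}. (Equivalently, Z_λ = ∏_{i<j}(t_i z_j + z_i) · s_λ(z₁,…,z_n) with s_λ the Schur polynomial.) -/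
open Finset

noncomputable section

/-- The sum `d_k(𝔗)` of the `k`-th row (0-indexed) of the triangular array `T`;
entries outside the triangle vanish, so summing over `range n` suffices. -/
def rowSum (n : ℕ) (T : ℕ → ℕ → ℤ) (k : ℕ) : ℤ := ∑ j ∈ Finset.range n, T k j

/-- `T` encodes a strict Gelfand–Tsetlin pattern with `n` rows (rows `0,…,n−1`, row `k`
having entries in columns `k,…,n−1`) with top row `T 0 j = λ_j + (n − 1 − j)`, where all
values outside the triangle are `0`. The conditions are: interleaving
`T k (j−1) ≥ T (k+1) j ≥ T k j` and strict decrease along each row. -/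
def IsGT (n : ℕ) (lam : ℕ → ℕ) (T : ℕ → ℕ → ℤ) : Prop :=
  (∀ k j : ℕ, ¬(k ≤ j ∧ j < n) → T k j = 0) ∧
  (∀ j : ℕ, j < n → T 0 j = (lam j : ℤ) + (n : ℤ) - 1 - (j : ℤ)) ∧
  (∀ k j : ℕ, k + 1 ≤ j → j < n →
    T k (j - 1) ≥ T (k + 1) j ∧ T (k + 1) j ≥ T k j) ∧
  (∀ k j : ℕ, k ≤ j → j + 1 < n → T k j > T k (j + 1))

/-- The total number of left-leaning entries of the pattern:
entries `T k j` (`1 ≤ k ≤ j < n`) with `T k j = T (k−1) (j−1)`. -/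
def leftCount (n : ℕ) (T : ℕ → ℕ → ℤ) : ℕ :=
  ((Finset.range n ×ˢ Finset.range n).filter
    (fun p => 1 ≤ p.1 ∧ p.1 ≤ p.2 ∧ T p.1 p.2 = T (p.1 - 1) (p.2 - 1))).card

/-- The total number of special entries of the pattern:
entries `T k j` (`1 ≤ k ≤ j < n`) that are neither left- nor right-leaning. -/
def specialCount (n : ℕ) (T : ℕ → ℕ → ℤ) : ℕ :=
  ((Finset.range n ×ˢ Finset.range n).filter
    (fun p => 1 ≤ p.1 ∧ p.1 ≤ p.2 ∧ T p.1 p.2 ≠ T (p.1 - 1) (p.2 - 1)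
      ∧ T p.1 p.2 ≠ T (p.1 - 1) p.2)).card

/-- The number `l_r(𝔗)` of left-leaning entries in row `r` (0-indexed, `r ≥ 1`). -/
def leftRow (n r : ℕ) (T : ℕ → ℕ → ℤ) : ℕ :=
  ((Finset.range n).filter
    (fun j => r ≤ j ∧ T r j = T (r - 1) (j - 1))).card

/-- The number `s_r(𝔗)` of special entries in row `r` (0-indexed, `r ≥ 1`). -/
def specialRow (n r : ℕ) (T : ℕ → ℕ → ℤ) : ℕ :=
  ((Finset.range n).filter
    (fun j => r ≤ j ∧ T r j ≠ T (r - 1) (j - 1) ∧ T r j ≠ T (r - 1) j)).card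

/-- The partition function `Z_λ(z₁,…,z_n; t₁,…,t_n)` of the Gamma ice model, written as a
sum over strict Gelfand–Tsetlin patterns with top row `λ + ρ`. -/
def Zice (n : ℕ) (lam : ℕ → ℕ) (z t : ℕ → ℂ) : ℂ :=
  ∑ᶠ (T : ℕ → ℕ → ℤ) (_ : IsGT n lam T),
    (∏ k ∈ Finset.range n, z k ^ (rowSum n T k - rowSum n T (k + 1))) *
      ∏ k ∈ Finset.range (n - 1),
        (t k ^ leftRow n (k + 1) T * (t k + 1) ^ specialRow n (k + 1) T)

/-- Strict Gelfand–Tsetlin patterns with `n` rows and top row `α`. -/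
def gtSet (n : ℕ) (α : Fin n → ℕ) : Set (ℕ → ℕ → ℤ) :=
  {T | (∀ k j : ℕ, ¬(k ≤ j ∧ j < n) → T k j = 0) ∧
    (∀ j : Fin n, T 0 j = α j) ∧
    (∀ k j : ℕ, k + 1 ≤ j → j < n → T k (j - 1) ≥ T (k + 1) j ∧ T (k + 1) j ≥ T k j) ∧
    (∀ k j : ℕ, k ≤ j → j + 1 < n → T k j > T k (j + 1))}

/-- The rows that interleave with `α`, not necessarily strictly decreasing. -/
def interleaving {n : ℕ} (α : Fin (n + 1) → ℕ) : Finset (Fin n → ℕ) :=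
  Fintype.piFinset fun i => Icc (α i.succ) (α i.castSucc)

open Classical in
/-- The strictly decreasing rows that interleave with `α`. -/
def strictInterleaving {n : ℕ} (α : Fin (n + 1) → ℕ) : Finset (Fin n → ℕ) :=
  (interleaving α).filter StrictAnti

/-- The array with top row `α` whose remaining rows are those of `T`. -/
def gtCons {n : ℕ} (α : Fin (n + 1) → ℕ) (T : ℕ → ℕ → ℤ) : ℕ → ℕ → ℤ
  | 0, j => if h : j < n + 1 then α ⟨j, h⟩ else 0
  | _ + 1, 0 => 0
  | k + 1, j + 1 => T k j

/-- The weight of a pattern, with a harmless additional factor for the empty row `n`. -/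
def gtWeight (n : ℕ) (z t : ℕ → ℂ) (T : ℕ → ℕ → ℤ) : ℂ :=
  (∏ k ∈ range n, z k ^ (rowSum n T k - rowSum n T (k + 1))) *
    ∏ k ∈ range n, (t k ^ leftRow n (k + 1) T * (t k + 1) ^ specialRow n (k + 1) T)

/-- The weight of an entry `b` with upper left neighbour `a` and upper right neighbour `c`. -/
def entryWeight (t : ℂ) (a c b : ℕ) : ℂ := if b = a then t else if b = c then 1 else t + 1

lemma gtCons_injective {n : ℕ} (α : Fin (n + 1) → ℕ) : Function.Injective (gtCons α) := by
  intro T T' h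
  funext k j
  exact congrFun (congrFun h (k + 1)) (j + 1)

lemma gtSet_zero (α : Fin 0 → ℕ) : gtSet 0 α = {0} := by
  ext T
  simp only [gtSet, Set.mem_ofPred_eq, Set.mem_singleton_iff]
  constructor
  · intro h
    funext k j
    exact h.1 k j (by omega)
  · rintro rfl
    exact ⟨fun _ _ _ => rfl, fun j => j.elim0, by omega, by omega⟩

lemma gtSet_succ {n : ℕ} {α : Fin (n + 1) → ℕ} (hα : StrictAnti α) :
    gtSet (n + 1) α = ⋃ β ∈ strictInterleaving α, gtCons α '' gtSet n β := by
  ext T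
  simp only [Set.mem_iUnion, Set.mem_image, strictInterleaving, interleaving, mem_filter,
    Fintype.mem_piFinset, mem_Icc, exists_prop]
  constructor
  · rintro ⟨h0, htop, hint, hstr⟩
    have hlow (j : Fin n) : (α j.succ : ℤ) ≤ T 1 (j + 1) := by
      have h1 := (hint 0 (j + 1) (by omega) (by omega)).2
      have h2 := htop j.succ
      simp only [Fin.val_succ] at h2
      rw [← h2]; exact h1
    have hupp (j : Fin n) : T 1 (j + 1) ≤ α j.castSucc := by
      have h1 := (hint 0 (j + 1) (by omega) (by omega)).1
      have h2 := htop j.castSucc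
      simp only [Fin.val_castSucc] at h2
      rw [← h2]; exact h1
    refine ⟨fun j => (T 1 (j + 1)).toNat, ⟨fun j => ?_, fun i j hij => ?_⟩,
      fun k j => T (k + 1) (j + 1), ⟨?_, ?_, ?_, ?_⟩, ?_⟩
    · have := hlow j
      have := hupp j
      show α j.succ ≤ (T 1 (j + 1)).toNat ∧ (T 1 (j + 1)).toNat ≤ α j.castSucc
      omega
    · have h1 := hlow j
      have h2 := hlow i
      have hanti (d : ℕ) : ∀ m : ℕ, 1 ≤ m → m + d + 1 < n + 1 → T 1 (m + d + 1) < T 1 m := by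
        induction d with
        | zero => intro m hm hd; exact hstr 1 m hm hd
        | succ d ih =>
          intro m hm hd
          have := ih m hm (by omega)
          have := hstr 1 (m + d + 1) (by omega) (by omega)
          rw [← add_assoc]
          omega
      have h3 := hanti (j - i - 1) (i + 1) (by omega) (by omega)
      rw [show (i : ℕ) + 1 + (j - i - 1) + 1 = j + 1 by omega] at h3
      show (T 1 (j + 1)).toNat < (T 1 (i + 1)).toNat
      omega
    · intro k j h
      exact h0 _ _ (by omega)
    · intro j
      have := hlow j
      show T 1 (j + 1) = (T 1 (j + 1)).toNat
      omega
    · intro k j h1 h2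
      have := hint (k + 1) (j + 1) (by omega) (by omega)
      rwa [show j + 1 - 1 = j - 1 + 1 by omega] at this
    · intro k j h1 h2
      exact hstr (k + 1) (j + 1) (by omega) (by omega)
    · funext k j
      rcases k with _ | k
      · simp only [gtCons]
        split_ifs with h
        · exact (htop ⟨j, h⟩).symm
        · exact (h0 0 j (by omega)).symm
      · rcases j with _ | j
        · exact (h0 _ _ (by omega)).symm
        · rfl
  · rintro ⟨β, ⟨hβ, -⟩, T, ⟨h0, htop, hint, hstr⟩, rfl⟩
    refine ⟨?_, ?_, ?_, ?_⟩
    · intro k j h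
      rcases k with _ | k
      · simp only [gtCons]
        rw [dif_neg (by omega)]
      · rcases j with _ | j
        · rfl
        · exact h0 _ _ (by omega)
    · intro j
      exact dif_pos j.isLt
    · intro k j h1 h2
      obtain ⟨j, rfl⟩ : ∃ m, j = m + 1 := ⟨j - 1, by omega⟩
      rcases k with _ | k
      · have h3 := htop ⟨j, by omega⟩
        have h4 := hβ ⟨j, by omega⟩
        simp only [Fin.castSucc_mk, Fin.succ_mk] at h3 h4
        simp only [gtCons, Nat.add_sub_cancel]
        rw [dif_pos (by omega), dif_pos h2, h3]
        exact_mod_cast h4.symm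
      · obtain ⟨j, rfl⟩ : ∃ m, j = m + 1 := ⟨j - 1, by omega⟩
        exact hint k (j + 1) (by omega) (by omega)
    · intro k j h1 h2
      rcases k with _ | k
      · simp only [gtCons]
        rw [dif_pos (by omega), dif_pos h2]
        exact_mod_cast hα (Fin.mk_lt_mk.2 (Nat.lt_succ_self j))
      · obtain ⟨j, rfl⟩ : ∃ m, j = m + 1 := ⟨j - 1, by omega⟩
        exact hstr k j (by omega) (by omega)

lemma strictAnti_of_mem_strictInterleaving {n : ℕ} {α : Fin (n + 1) → ℕ} {β : Fin n → ℕ}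
    (hβ : β ∈ strictInterleaving α) : StrictAnti β := by
  classical
  exact (mem_filter.1 hβ).2

lemma gtSet_finite (n : ℕ) : ∀ {α : Fin n → ℕ}, StrictAnti α → (gtSet n α).Finite := by
  induction n with
  | zero => intro α _; rw [gtSet_zero]; exact Set.finite_singleton _
  | succ n ih =>
    intro α hα
    rw [gtSet_succ hα]
    exact (strictInterleaving α).finite_toSet.biUnion fun β hβ =>
      (ih (strictAnti_of_mem_strictInterleaving hβ)).image _

lemma finsum_gtSet_succ {n : ℕ} {α : Fin (n + 1) → ℕ} (hα : StrictAnti α)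
    (f : (ℕ → ℕ → ℤ) → ℂ) :
    ∑ᶠ T ∈ gtSet (n + 1) α, f T =
      ∑ β ∈ strictInterleaving α, ∑ᶠ T ∈ gtSet n β, f (gtCons α T) := by
  rw [gtSet_succ hα]
  have hdisj : (strictInterleaving α : Set (Fin n → ℕ)).PairwiseDisjoint
      fun β => gtCons α '' gtSet n β := by
    intro β _ β' _ hne
    rw [Function.onFun, Set.disjoint_left]
    rintro _ ⟨T, hT, rfl⟩ ⟨T', hT', h⟩
    apply hne
    obtain rfl := gtCons_injective α h
    funext j
    have h1 := hT.2.1 j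
    have h2 := hT'.2.1 j
    exact_mod_cast h1.symm.trans h2
  have := finsum_mem_biUnion (f := f) hdisj (strictInterleaving α).finite_toSet fun β hβ =>
    (gtSet_finite n (strictAnti_of_mem_strictInterleaving hβ)).image _
  simp only [SetLike.mem_coe] at this
  rw [this, ← finsum_mem_coe_finset]
  refine finsum_congr fun β => finsum_congr fun _ => ?_
  exact finsum_mem_image (gtCons_injective α).injOn

lemma rowSum_gtCons_zero {n : ℕ} (α : Fin (n + 1) → ℕ) (T : ℕ → ℕ → ℤ) :
    rowSum (n + 1) (gtCons α T) 0 = ∑ j, (α j : ℤ) := by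
  rw [rowSum, sum_range]
  exact sum_congr rfl fun j _ => dif_pos j.isLt

lemma rowSum_gtCons_succ {n : ℕ} (α : Fin (n + 1) → ℕ) (T : ℕ → ℕ → ℤ) (k : ℕ) :
    rowSum (n + 1) (gtCons α T) (k + 1) = rowSum n T k := by
  rw [rowSum, sum_range_succ']
  simp [gtCons, rowSum]

lemma leftRow_gtCons_succ {n : ℕ} (α : Fin (n + 1) → ℕ) (T : ℕ → ℕ → ℤ) (k : ℕ) :
    leftRow (n + 1) (k + 1 + 1) (gtCons α T) = leftRow n (k + 1) T := by
  rw [leftRow, leftRow, card_filter, card_filter, sum_range_succ']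
  simp only [Nat.add_sub_cancel, nonpos_iff_eq_zero, Nat.add_eq_zero_iff, one_ne_zero, and_false,
    false_and, if_false, add_zero]
  refine sum_congr rfl fun j _ => ?_
  rcases j with _ | j <;> simp [gtCons]

lemma specialRow_gtCons_succ {n : ℕ} (α : Fin (n + 1) → ℕ) (T : ℕ → ℕ → ℤ) (k : ℕ) :
    specialRow (n + 1) (k + 1 + 1) (gtCons α T) = specialRow n (k + 1) T := by
  rw [specialRow, specialRow, card_filter, card_filter, sum_range_succ']
  simp only [Nat.add_sub_cancel, nonpos_iff_eq_zero, Nat.add_eq_zero_iff, one_ne_zero, and_false,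
    false_and, if_false, add_zero]
  refine sum_congr rfl fun j _ => ?_
  rcases j with _ | j <;> simp [gtCons]

lemma pow_leftRow_mul_pow_specialRow_gtCons {n : ℕ} (α : Fin (n + 1) → ℕ) {β : Fin n → ℕ}
    {T : ℕ → ℕ → ℤ} (hT : T ∈ gtSet n β) (t : ℂ) :
    t ^ leftRow (n + 1) 1 (gtCons α T) * (t + 1) ^ specialRow (n + 1) 1 (gtCons α T) =
      ∏ i : Fin n, entryWeight t (α i.castSucc) (α i.succ) (β i) := by
  rw [leftRow, specialRow, ← prod_const, ← prod_const, prod_filter, prod_filter,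
    ← prod_mul_distrib, prod_range_succ', prod_range]
  simp only [nonpos_iff_eq_zero, one_ne_zero, false_and, if_false, mul_one]
  refine prod_congr rfl fun i _ => ?_
  have h := hT.2.1 i
  have hl : gtCons α T 0 i = α i.castSucc := dif_pos i.castSucc.isLt
  have hr : gtCons α T 0 (i + 1) = α i.succ := dif_pos i.succ.isLt
  have hb : gtCons α T 1 (i + 1) = β i := h
  simp only [Nat.add_sub_cancel, Nat.sub_self, hl, hr, hb, entryWeight, Nat.cast_inj,
    le_add_iff_nonneg_left, zero_le, true_and]
  by_cases h1 : β i = α i.castSucc <;> by_cases h2 : β i = α i.succ <;> simp [h1, h2]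

lemma gtWeight_gtCons {n : ℕ} {α : Fin (n + 1) → ℕ} {β : Fin n → ℕ}
    (hβ : β ∈ interleaving α) {T : ℕ → ℕ → ℤ} (hT : T ∈ gtSet n β) (z t : ℕ → ℂ) :
    gtWeight (n + 1) z t (gtCons α T) =
      z 0 ^ α (Fin.last n) * (∏ i : Fin n, entryWeight (t 0) (α i.castSucc) (α i.succ) (β i) *
        z 0 ^ (α i.castSucc - β i)) *
        gtWeight n (fun k => z (k + 1)) (fun k => t (k + 1)) T := by
  have hβ' (i : Fin n) : β i ≤ α i.castSucc := (mem_Icc.1 (Fintype.mem_piFinset.1 hβ i)).2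
  have hrow : rowSum n T 0 = ∑ j, (β j : ℤ) := by
    rw [rowSum, sum_range]
    exact sum_congr rfl fun j _ => hT.2.1 j
  have hexp : ∑ j, (α j : ℤ) - ∑ j, (β j : ℤ) =
      ((α (Fin.last n) + ∑ i : Fin n, (α i.castSucc - β i) : ℕ) : ℤ) := by
    rw [Fin.sum_univ_castSucc]
    push_cast [hβ', sum_sub_distrib]
    ring
  rw [gtWeight, prod_range_succ', prod_range_succ', zero_add,
    pow_leftRow_mul_pow_specialRow_gtCons α hT]
  simp only [rowSum_gtCons_succ, rowSum_gtCons_zero, leftRow_gtCons_succ,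
    specialRow_gtCons_succ, gtWeight]
  rw [hrow, hexp, zpow_natCast, pow_add,
    ← prod_pow_eq_pow_sum, prod_mul_distrib (s := (univ : Finset (Fin n)))]
  ring

lemma sub_mul_sum_entryWeight (t z x : ℂ) {a c : ℕ} (h : c < a) :
    (z - x) * ∑ b ∈ Icc c a, entryWeight t a c b * z ^ (a - b) * x ^ b =
      (t * x + z) * (z ^ (a - c) * x ^ c - x ^ a) := by
  obtain ⟨m, rfl⟩ : ∃ m, a = c + (m + 1) := ⟨a - c - 1, by omega⟩
  have hIcc : Icc c (c + (m + 1)) = Ico c (c + (m + 2)) := by ext; simp; omega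
  rw [hIcc, sum_Ico_eq_sum_range, Nat.add_sub_cancel_left, sum_range_succ, sum_range_succ']
  have hmid : ∑ i ∈ range m, entryWeight t (c + (m + 1)) c (c + (i + 1)) *
      z ^ (c + (m + 1) - (c + (i + 1))) * x ^ (c + (i + 1)) =
      (t + 1) * z * x ^ (c + 1) * ∑ i ∈ range m, x ^ i * z ^ (m - 1 - i) := by
    rw [mul_sum]
    refine sum_congr rfl fun i hi => ?_
    have := mem_range.1 hi
    rw [entryWeight, if_neg (by omega), if_neg (by omega),
      show c + (m + 1) - (c + (i + 1)) = m - 1 - i + 1 by omega]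
    ring
  have hgeom := geom_sum₂_mul x z m
  rw [hmid, entryWeight, entryWeight, if_neg (by omega), if_pos (by omega), if_pos rfl]
  simp only [add_zero, Nat.add_sub_cancel_left, Nat.sub_self, pow_zero]
  linear_combination (-(t + 1) * z * x ^ (c + 1)) * hgeom

lemma prod_range_prod_Ico_succ (n : ℕ) (f : ℕ → ℕ → ℂ) :
    ∏ i ∈ range (n + 1), ∏ j ∈ Ico (i + 1) (n + 1), f i j =
      (∏ j : Fin n, f 0 (j + 1)) *
        ∏ i ∈ range n, ∏ j ∈ Ico (i + 1) n, f (i + 1) (j + 1) := by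
  rw [prod_range_succ', mul_comm, prod_Ico_eq_prod_range, prod_range]
  congr 1
  · simp only [zero_add, add_comm]
    rfl
  · exact prod_congr rfl fun i _ => (prod_Ico_add' (f (i + 1)) (i + 1) n 1).symm

lemma det_pow_succ {n : ℕ} {α : Fin (n + 1) → ℕ} (hα : StrictAnti α) (z : ℕ → ℂ) :
    (Matrix.of fun i j : Fin (n + 1) => z i ^ α j).det =
      z 0 ^ α (Fin.last n) * (Matrix.of fun i j : Fin n =>
        z 0 ^ (α j.castSucc - α j.succ) * z (i + 1) ^ α j.succ - z (i + 1) ^ α j.castSucc).det := by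
  set M : Matrix (Fin (n + 1)) (Fin (n + 1)) ℂ := Matrix.of fun i j => z i ^ α j
  set M' : Matrix (Fin (n + 1)) (Fin (n + 1)) ℂ := Matrix.of fun i j =>
    Fin.lastCases (motive := fun _ => ℂ) (z i ^ α (Fin.last n))
      (fun j => z i ^ α j.castSucc - z 0 ^ (α j.castSucc - α j.succ) * z i ^ α j.succ) j
  have hdet : M.det = M'.det := by
    rw [← Matrix.det_submatrix_equiv_self Fin.revPerm M,
      ← Matrix.det_submatrix_equiv_self Fin.revPerm M']
    refine Matrix.det_eq_of_forall_col_eq_smul_add_pred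
      (fun j => z 0 ^ (α j.rev.castSucc - α j.rev.succ)) (fun i => ?_) fun i j => ?_
    · simp [M, M']
    · simp [M, M', Fin.rev_succ, Fin.rev_castSucc]
  rw [hdet, Matrix.det_succ_row_zero, Fin.sum_univ_castSucc, sum_eq_zero, zero_add]
  · have hneg : M'.submatrix Fin.succ (Fin.last n).succAbove = -(Matrix.of fun i j : Fin n =>
        z 0 ^ (α j.castSucc - α j.succ) * z (i + 1) ^ α j.succ -
          z (i + 1) ^ α j.castSucc) := by
      ext i j
      simp [M']
    rw [hneg, Matrix.det_neg]
    simp only [M', Matrix.of_apply, Fin.lastCases_last, Fin.val_last, Fin.val_zero,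
      Fintype.card_fin]
    have : (-1 : ℂ) ^ n * (-1) ^ n = 1 := by rw [← mul_pow]; simp
    linear_combination (z 0 ^ α (Fin.last n) * (Matrix.of fun i j : Fin n =>
        z 0 ^ (α j.castSucc - α j.succ) * z (i + 1) ^ α j.succ -
          z (i + 1) ^ α j.castSucc).det) * this
  · intro j _
    have : α j.succ ≤ α j.castSucc := (hα j.castSucc_lt_succ).le
    simp [M', ← pow_add, this]

lemma sum_interleaving_mul_det {n : ℕ} (α : Fin (n + 1) → ℕ) (w : Fin n → ℕ → ℂ)
    (z : ℕ → ℂ) :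
    ∑ β ∈ strictInterleaving α, (∏ i, w i (β i)) *
        (Matrix.of fun i j : Fin n => z i ^ β j).det =
      (Matrix.of fun i j : Fin n =>
        ∑ b ∈ Icc (α j.succ) (α j.castSucc), w j b * z i ^ b).det := by
  classical
  have hall : ∑ β ∈ strictInterleaving α, (∏ i, w i (β i)) *
        (Matrix.of fun i j : Fin n => z i ^ β j).det =
      ∑ β ∈ interleaving α, (∏ i, w i (β i)) *
        (Matrix.of fun i j : Fin n => z i ^ β j).det := by
    refine sum_subset (filter_subset _ _) fun β hβ hns => ?_
    have hanti : Antitone β := by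
      rcases n with _ | n
      · exact fun i => i.elim0
      · refine Fin.antitone_iff_succ_le.2 fun i => ?_
        have h1 := mem_Icc.1 (Fintype.mem_piFinset.1 hβ i.succ)
        have h2 := mem_Icc.1 (Fintype.mem_piFinset.1 hβ i.castSucc)
        exact h1.2.trans h2.1
    have hninj : ¬ Function.Injective β := fun hinj =>
      hns (mem_filter.2 ⟨hβ, hanti.strictAnti_of_injective hinj⟩)
    obtain ⟨i, j, hij, hne⟩ := Function.not_injective_iff.1 hninj
    rw [Matrix.det_zero_of_column_eq hne fun k => by simp [hij], mul_zero]
  rw [hall, ← Matrix.det_transpose]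
  have h := (Matrix.detRowAlternating (R := ℂ) (n := Fin n)).toMultilinearMap.map_sum_finset
    (fun j b => fun i : Fin n => w j b * z i ^ b) fun j => Icc (α j.succ) (α j.castSucc)
  have hM : (Matrix.of fun i j : Fin n =>
      ∑ b ∈ Icc (α j.succ) (α j.castSucc), w j b * z i ^ b).transpose =
      fun j => ∑ b ∈ Icc (α j.succ) (α j.castSucc), fun i : Fin n => w j b * z i ^ b := by
    ext j i
    simp
  rw [hM]
  refine Eq.trans ?_ h.symm
  refine sum_congr rfl fun β _ => ?_
  rw [← Matrix.det_transpose (Matrix.of _)]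
  exact (Matrix.det_mul_column (fun i => w i (β i)) _).symm

theorem finsum_gtWeight_mul_prod (n : ℕ) : ∀ {α : Fin n → ℕ}, StrictAnti α → ∀ z t : ℕ → ℂ,
    (∑ᶠ T ∈ gtSet n α, gtWeight n z t T) *
      ∏ i ∈ range n, ∏ j ∈ Ico (i + 1) n, (z i - z j) =
    (∏ i ∈ range n, ∏ j ∈ Ico (i + 1) n, (t i * z j + z i)) *
      (Matrix.of fun i j : Fin n => z i ^ α j).det := by
  induction n with
  | zero =>
    intro α _ z t
    rw [gtSet_zero, finsum_mem_singleton]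
    simp [gtWeight]
  | succ n ih =>
    intro α hα z t
    set w : Fin n → ℕ → ℂ := fun i b =>
      entryWeight (t 0) (α i.castSucc) (α i.succ) b * z 0 ^ (α i.castSucc - b)
    set V := ∏ i ∈ range n, ∏ j ∈ Ico (i + 1) n, (z (i + 1) - z (j + 1))
    set P := ∏ i ∈ range n, ∏ j ∈ Ico (i + 1) n, (t (i + 1) * z (j + 1) + z (i + 1))
    have hsum : (∑ᶠ T ∈ gtSet (n + 1) α, gtWeight (n + 1) z t T) * V =
        z 0 ^ α (Fin.last n) * P * (Matrix.of fun i j : Fin n =>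
          ∑ b ∈ Icc (α j.succ) (α j.castSucc), w j b * z (i + 1) ^ b).det := by
      rw [finsum_gtSet_succ hα, ← sum_interleaving_mul_det α w fun k => z (k + 1), sum_mul,
        mul_sum]
      refine sum_congr rfl fun β hβ => ?_
      have hβ' := strictAnti_of_mem_strictInterleaving hβ
      have hstep : ∑ᶠ T ∈ gtSet n β, gtWeight (n + 1) z t (gtCons α T) =
          z 0 ^ α (Fin.last n) * (∏ i, w i (β i)) *
            ∑ᶠ T ∈ gtSet n β, gtWeight n (fun k => z (k + 1)) (fun k => t (k + 1)) T := by
        rw [mul_finsum_mem]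
        refine finsum_mem_congr rfl fun T hT => ?_
        classical
        exact gtWeight_gtCons (mem_filter.1 hβ).1 hT z t
      rw [hstep, mul_assoc, ih hβ' (fun k => z (k + 1)) fun k => t (k + 1)]
      ring
    have hcol : (∏ i : Fin n, (z 0 - z (i + 1))) * (Matrix.of fun i j : Fin n =>
          ∑ b ∈ Icc (α j.succ) (α j.castSucc), w j b * z (i + 1) ^ b).det =
        (∏ i : Fin n, (t 0 * z (i + 1) + z 0)) * (Matrix.of fun i j : Fin n =>
          z 0 ^ (α j.castSucc - α j.succ) * z (i + 1) ^ α j.succ -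
            z (i + 1) ^ α j.castSucc).det := by
      rw [← Matrix.det_mul_column, ← Matrix.det_mul_column]
      congr 1
      ext i j
      exact sub_mul_sum_entryWeight (t 0) (z 0) (z (i + 1)) (hα j.castSucc_lt_succ)
    rw [prod_range_prod_Ico_succ, prod_range_prod_Ico_succ, det_pow_succ hα]
    linear_combination (∏ i : Fin n, (z 0 - z (i + 1))) * hsum +
      (z 0 ^ α (Fin.last n) * P) * hcol

lemma gtWeight_eq (n : ℕ) (z t : ℕ → ℂ) (T : ℕ → ℕ → ℤ) :
    gtWeight n z t T = (∏ k ∈ range n, z k ^ (rowSum n T k - rowSum n T (k + 1))) *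
      ∏ k ∈ range (n - 1),
        (t k ^ leftRow n (k + 1) T * (t k + 1) ^ specialRow n (k + 1) T) := by
  rcases n with _ | n
  · rfl
  · have h1 : leftRow (n + 1) (n + 1) T = 0 :=
      card_eq_zero.2 (filter_false_of_mem fun j hj => by have := mem_range.1 hj; omega)
    have h2 : specialRow (n + 1) (n + 1) T = 0 :=
      card_eq_zero.2 (filter_false_of_mem fun j hj => by have := mem_range.1 hj; omega)
    rw [gtWeight, prod_range_succ (n := n) (fun k => t k ^ _ * _), h1, h2]
    simp

lemma isGT_iff_mem_gtSet (n : ℕ) (lam : ℕ → ℕ) (T : ℕ → ℕ → ℤ) :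
    IsGT n lam T ↔ T ∈ gtSet n fun j => lam j + (n - 1 - (j : ℕ)) := by
  have h : (∀ j : ℕ, j < n → T 0 j = (lam j : ℤ) + (n : ℤ) - 1 - (j : ℤ)) ↔
      ∀ j : Fin n, T 0 j = ((lam j + (n - 1 - (j : ℕ)) : ℕ) : ℤ) := by
    rw [Fin.forall_iff]
    refine forall₂_congr fun j hj => ?_
    simp only
    omega
  rw [IsGT, h]
  rfl

theorem stmt17 (n : ℕ) (hn : 1 ≤ n) (lam : ℕ → ℕ)
    (hlam : ∀ i j : ℕ, i ≤ j → j < n → lam j ≤ lam i)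
    (z t : ℕ → ℂ) :
    Zice n lam z t *
      ∏ i ∈ Finset.range n, ∏ j ∈ Finset.Ico (i + 1) n, (z i - z j)
    = (∏ i ∈ Finset.range n, ∏ j ∈ Finset.Ico (i + 1) n, (t i * z j + z i)) *
        (Matrix.of fun i j : Fin n => z i ^ (lam j + (n - 1 - (j : ℕ)))).det := by
  have hα : StrictAnti fun j : Fin n => lam j + (n - 1 - (j : ℕ)) := fun i j hij => by
    have := hlam i j (Fin.le_def.1 hij.le) j.isLt
    have := Fin.lt_def.1 hij
    simp only
    omega
  rw [← finsum_gtWeight_mul_prod n hα z t, Zice]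
  simp only [isGT_iff_mem_gtSet, gtWeight_eq]
end
end
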